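/- As u → (1/27)⁻, the function F(u) = ∑_{n≥1} (3n)!/(n!n!(n+1)!) u^n converges to a finite limit F(1/27), and the singular behavior F(1/27) − F(u) ∼ C·(1/27 − u)·log(1/(1/27 − u)) holds for some constant C > 0; in particular F extends continuously to [0, 1/27] but F' diverges logarithmically at 1/27. -/

import Mathlib

open Nat

/-- The coefficients `(3n)!/(n!·n!·(n+1)!)` (for `n ≥ 1`, and `0` for `n = 0`). -/
noncomputable def fcCoeff (n : ℕ) : ℝ :=
  if n = 0 then 0 else ((3 * n)! : ℝ) / ((n ! : ℝ) * (n !) * ((n + 1)!))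

/-- `F(u) = ∑_{n≥1} (3n)!/(n!·n!·(n+1)!) u^n`. -/
noncomputable def Fser (u : ℝ) : ℝ := ∑' n : ℕ, fcCoeff n * u ^ n

open Filter Topology

/-- normalized coefficients -/
noncomputable def rr (m : ℕ) : ℝ := fcCoeff (m + 1) * ((m + 1) * (m + 2)) / 27 ^ (m + 1)

/-- telescoping weights -/
noncomputable def qq (m : ℕ) : ℝ := 1 / (((m : ℝ) + 1) * (m + 2))

lemma qq_pos (m : ℕ) : 0 < qq m := by unfold qq; positivity

lemma rr_pos (m : ℕ) : 0 < rr m := by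
  unfold rr fcCoeff
  rw [if_neg (Nat.succ_ne_zero m)]
  positivity

lemma term_eq (m : ℕ) (u : ℝ) :
    fcCoeff (m + 1) * u ^ (m + 1) = rr m * qq m * (27 * u) ^ (m + 1) := by
  unfold rr qq
  rw [mul_pow]
  field_simp

lemma rr_stirling (m : ℕ) :
    rr m = Stirling.stirlingSeq (3 * (m + 1)) / Stirling.stirlingSeq (m + 1) ^ 3 * (√3 / 2) := by
  unfold rr fcCoeff Stirling.stirlingSeq
  rw [if_neg (Nat.succ_ne_zero m), Nat.factorial_succ (m + 1)]
  push_cast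
  have hx : (0 : ℝ) < (m : ℝ) + 1 := by positivity
  have h1 : √(2 * (3 * ((m : ℝ) + 1))) = √3 * √(2 * ((m : ℝ) + 1)) := by
    rw [← Real.sqrt_mul (by norm_num)]; congr 1; ring
  have h2 : (√(2 * ((m : ℝ) + 1))) ^ 2 = 2 * ((m : ℝ) + 1) := Real.sq_sqrt (by positivity)
  have h3 : √(2 * ((m : ℝ) + 1)) ≠ 0 := by positivity
  have h4 : (3 * ((m : ℝ) + 1) / Real.exp 1) ^ (3 * (m + 1))
      = 27 ^ (m + 1) * ((((m : ℝ) + 1) / Real.exp 1) ^ (m + 1)) ^ 3 := by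
    rw [mul_div_assoc, mul_pow, pow_mul, ← pow_mul _ (m + 1) 3, mul_comm (m + 1) 3]
    norm_num
  rw [h1, h4]
  have h5 : (((m : ℝ) + 1) / Real.exp 1) ^ (m + 1) ≠ 0 := by positivity
  have h6 : ((m + 1)! : ℝ) ≠ 0 := by positivity
  have h7 : (√3 : ℝ) ≠ 0 := by positivity
  generalize (((m : ℝ) + 1) / Real.exp 1) ^ (m + 1) = A at *
  generalize √(2 * ((m : ℝ) + 1)) = B at *
  generalize ((m + 1)! : ℝ) = D at *
  have hm : (m : ℝ) + 1 = B ^ 2 / 2 := by linarith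
  have hm2 : (m : ℝ) + 2 = B ^ 2 / 2 + 1 := by linarith
  have hm3 : (m : ℝ) + 1 + 1 = B ^ 2 / 2 + 1 := by linarith
  have hp : B ^ 2 / 2 + 1 ≠ 0 := by positivity
  rw [hm3, hm2, hm]
  field_simp

lemma rr_tendsto : ∃ K : ℝ, 0 < K ∧ Tendsto rr atTop (𝓝 K) := by
  obtain ⟨a, ha, h⟩ := Stirling.stirlingSeq_has_pos_limit_a
  refine ⟨a / a ^ 3 * (√3 / 2), by positivity, ?_⟩
  have e : rr = fun m : ℕ => Stirling.stirlingSeq (3 * (m + 1)) /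
      Stirling.stirlingSeq (m + 1) ^ 3 * (√3 / 2) := funext rr_stirling
  rw [e]
  have t1 : Tendsto (fun m : ℕ => m + 1) atTop atTop := tendsto_add_atTop_nat 1
  have t2 : Tendsto (fun m : ℕ => 3 * (m + 1)) atTop atTop :=
    tendsto_atTop_mono (fun m => by omega) t1
  exact (((h.comp t2).div ((h.comp t1).pow 3) (by positivity))).mul_const _

lemma qq_hasSum : HasSum qq 1 := by
  rw [hasSum_iff_tendsto_nat_of_nonneg (fun i => (qq_pos i).le)]
  have e : ∀ n : ℕ, ∑ i ∈ Finset.range n, qq i = 1 - 1 / ((n : ℝ) + 1) := by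
    intro n
    induction n with
    | zero => simp
    | succ k ih =>
      rw [Finset.sum_range_succ, ih]
      unfold qq
      push_cast
      have : (k : ℝ) + 1 + 1 ≠ 0 := by positivity
      field_simp
      ring
  simp_rw [e]
  simpa using (tendsto_one_div_add_atTop_nhds_zero_nat (𝕜 := ℝ)).const_sub 1

lemma W_hasSum (x : ℝ) (h0 : 0 < x) (h1 : x < 1) :
    HasSum (fun m => qq m * (1 - x ^ (m + 1))) ((1 - x) * (-Real.log (1 - x)) / x) := by
  have hl := Real.hasSum_pow_div_log_of_abs_lt_one (x := x) (by rw [abs_of_pos h0]; exact h1)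
  have hl2 := (hasSum_nat_add_iff' 1).mpr hl
  have hl3 := hl2.mul_left x⁻¹
  have := (qq_hasSum.sub hl).add hl3
  have e1 : ((1 - x) * (-Real.log (1 - x)) / x) = (1 - -Real.log (1 - x) +
      x⁻¹ * (-Real.log (1 - x) - ∑ i ∈ Finset.range 1, x ^ (i + 1) / ((i : ℝ) + 1))) := by
    simp
    field_simp
    ring
  rw [e1]
  rw [show (fun m => qq m * (1 - x ^ (m + 1))) = fun m : ℕ => qq m - x ^ (m + 1) / ((m : ℝ) + 1)
      + x⁻¹ * (x ^ (m + 1 + 1) / (((m + 1 : ℕ) : ℝ) + 1)) from ?_]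
  · exact this
  funext m
  · unfold qq
    push_cast
    have : (m : ℝ) + 1 + 1 ≠ 0 := by positivity
    have : (m : ℝ) + 2 ≠ 0 := by positivity
    have e : (m : ℝ) + 1 + 1 = m + 2 := by ring
    rw [e]
    field_simp
    ring

lemma rr_bdd : ∃ B : ℝ, 0 < B ∧ ∀ m, rr m ≤ B := by
  obtain ⟨K, hK, h⟩ := rr_tendsto
  obtain ⟨B, hB⟩ := h.bddAbove_range
  exact ⟨max B 1, by positivity, fun m => (hB ⟨m, rfl⟩).trans (le_max_left _ _)⟩

lemma summ_rq : Summable (fun m => rr m * qq m) := by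
  obtain ⟨B, hB, h⟩ := rr_bdd
  exact Summable.of_nonneg_of_le (fun m => (mul_pos (rr_pos m) (qq_pos m)).le)
    (fun m => mul_le_mul_of_nonneg_right (h m) (qq_pos m).le) (qq_hasSum.summable.mul_left B)

lemma summ_rqx (x : ℝ) (h0 : 0 ≤ x) (h1 : x ≤ 1) :
    Summable (fun m => rr m * qq m * x ^ (m + 1)) :=
  Summable.of_nonneg_of_le
    (fun m => mul_nonneg (mul_pos (rr_pos m) (qq_pos m)).le (by positivity))
    (fun m => mul_le_of_le_one_right (mul_pos (rr_pos m) (qq_pos m)).le (pow_le_one₀ h0 h1)) summ_rq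

lemma Fser_shift : Fser = fun u => ∑' m : ℕ, fcCoeff (m + 1) * u ^ (m + 1) := by
  funext u
  unfold Fser
  symm
  refine Nat.succ_injective.tsum_eq (f := fun n => fcCoeff n * u ^ n) ?_
  intro n hn
  rcases n with _ | n
  · simp [fcCoeff] at hn
  · exact ⟨n, rfl⟩

lemma Fser_eq (u : ℝ) : Fser u = ∑' m : ℕ, rr m * qq m * (27 * u) ^ (m + 1) := by
  rw [Fser_shift]
  exact tsum_congr fun m => term_eq m u

lemma abel_bound (K ε : ℝ) (hε : 0 < ε) (hK : Tendsto rr atTop (𝓝 K)) :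
    ∃ A : ℝ, ∀ x : ℝ, 0 < x → x < 1 →
      |(∑' m, rr m * qq m) - (∑' m, rr m * qq m * x ^ (m + 1))
        - K * ((1 - x) * (-Real.log (1 - x)) / x)|
      ≤ ε * ((1 - x) * (-Real.log (1 - x)) / x) + A * (1 - x) := by
  obtain ⟨N, hN⟩ := Metric.tendsto_atTop.mp hK ε hε
  refine ⟨∑ m ∈ Finset.range N, |rr m - K|, fun x h0 h1 => ?_⟩
  have hW := W_hasSum x h0 h1
  have hs := ((summ_rq.hasSum.sub (summ_rqx x h0.le h1.le).hasSum).sub (hW.mul_left K))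
  have hfin : HasSum (fun m => if m ∈ Finset.range N then |rr m - K| * (1 - x) else 0)
      ((∑ m ∈ Finset.range N, |rr m - K|) * (1 - x)) := by
    rw [Finset.sum_mul]
    have := hasSum_sum_of_ne_finset_zero (L := .unconditional ℕ) (s := Finset.range N)
      (f := fun m => if m ∈ Finset.range N then |rr m - K| * (1 - x) else 0)
      (fun b hb => by simp only [if_neg hb])
    convert this using 1
    exact Finset.sum_congr rfl fun m hm => by simp only [if_pos hm]
  have hb := (hW.mul_left ε).add hfin
  have key : ∀ m, |rr m * qq m - rr m * qq m * x ^ (m + 1) - K * (qq m * (1 - x ^ (m + 1)))|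
      ≤ ε * (qq m * (1 - x ^ (m + 1))) +
        (if m ∈ Finset.range N then |rr m - K| * (1 - x) else 0) := by
    intro m
    have hp : 0 ≤ 1 - x ^ (m + 1) := sub_nonneg.mpr (pow_le_one₀ h0.le h1.le)
    have hg : 0 ≤ qq m * (1 - x ^ (m + 1)) := mul_nonneg (qq_pos m).le hp
    have e : rr m * qq m - rr m * qq m * x ^ (m + 1) - K * (qq m * (1 - x ^ (m + 1)))
        = (rr m - K) * (qq m * (1 - x ^ (m + 1))) := by ring
    rw [e, abs_mul, abs_of_nonneg hg]
    split_ifs with hm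
    · have bern := one_add_mul_sub_le_pow (a := x) (by linarith) (m + 1)
      push_cast at bern
      have h3 : qq m * (1 - x ^ (m + 1)) ≤ 1 - x := by
        have : qq m * (1 - x ^ (m + 1)) ≤ qq m * (((m : ℝ) + 1) * (1 - x)) :=
          mul_le_mul_of_nonneg_left (by linarith) (qq_pos m).le
        refine this.trans ?_
        rw [← mul_assoc]
        refine mul_le_of_le_one_left (by linarith) ?_
        unfold qq
        rw [div_mul_eq_mul_div, div_le_one (by positivity)]
        nlinarith [(Nat.cast_nonneg m : (0 : ℝ) ≤ m)]
      have := mul_le_mul_of_nonneg_left h3 (abs_nonneg (rr m - K))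
      have := mul_nonneg hε.le hg
      linarith
    · rw [add_zero]
      refine mul_le_mul_of_nonneg_right ?_ hg
      have := hN m (by simpa using hm)
      rw [Real.dist_eq] at this
      exact this.le
  rw [← hs.tsum_eq, ← hb.tsum_eq]
  have := tsum_of_norm_bounded hb (f := fun m => rr m * qq m - rr m * qq m * x ^ (m + 1)
    - K * (qq m * (1 - x ^ (m + 1)))) key
  rwa [hb.tsum_eq] at *

lemma abel (K : ℝ) (hK : Tendsto rr atTop (𝓝 K)) :
    Tendsto (fun x : ℝ => ((∑' m, rr m * qq m) - (∑' m, rr m * qq m * x ^ (m + 1)))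
      / ((1 - x) * (-Real.log (1 - x)))) (𝓝[<] 1) (𝓝 K) := by
  have hsub : Tendsto (fun x : ℝ => 1 - x) (𝓝[<] 1) (𝓝[>] 0) := by
    refine tendsto_nhdsWithin_iff.mpr ⟨?_, ?_⟩
    · have : Tendsto (fun x : ℝ => 1 - x) (𝓝 1) (𝓝 (1 - 1)) :=
        (continuous_const.sub continuous_id).tendsto 1
      rw [sub_self] at this
      exact this.mono_left nhdsWithin_le_nhds
    · filter_upwards [self_mem_nhdsWithin] with x hx
      simpa using hx
  have hlog : Tendsto (fun x : ℝ => -Real.log (1 - x)) (𝓝[<] 1) atTop :=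
    tendsto_neg_atBot_atTop.comp (Real.tendsto_log_nhdsGT_zero.comp hsub)
  have hinv : Tendsto (fun x : ℝ => x⁻¹) (𝓝[<] 1) (𝓝 1) := by
    have := (continuousAt_inv₀ (one_ne_zero (α := ℝ))).tendsto
    rw [inv_one] at this
    exact this.mono_left nhdsWithin_le_nhds
  have hKx : Tendsto (fun x : ℝ => K * x⁻¹) (𝓝[<] 1) (𝓝 K) := by
    simpa using hinv.const_mul K
  suffices h : Tendsto (fun x : ℝ => ((∑' m, rr m * qq m) - (∑' m, rr m * qq m * x ^ (m + 1)))
      / ((1 - x) * (-Real.log (1 - x))) - K * x⁻¹) (𝓝[<] 1) (𝓝 0) by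
    simpa using h.add hKx
  rw [Metric.tendsto_nhds]
  intro ε hε
  obtain ⟨A, hA⟩ := abel_bound K (ε / 2) (by positivity) hK
  have hlim : Tendsto (fun x : ℝ => ε / 2 * x⁻¹ + A / (-Real.log (1 - x))) (𝓝[<] 1)
      (𝓝 (ε / 2 * 1 + 0)) := (hinv.const_mul _).add (hlog.const_div_atTop A)
  have hev := hlim.eventually (gt_mem_nhds (show ε / 2 * 1 + 0 < ε by linarith))
  have hpos : ∀ᶠ x : ℝ in 𝓝[<] 1, 0 < x :=
    nhdsWithin_le_nhds (lt_mem_nhds one_pos)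
  filter_upwards [hev, hpos, self_mem_nhdsWithin, hlog.eventually_gt_atTop 0] with x h1 h2 h3 h4
  have h3 : x < 1 := h3
  have h5 : 0 < 1 - x := by linarith
  have hb := hA x h2 h3
  rw [_root_.dist_zero_right, Real.norm_eq_abs]
  refine lt_of_le_of_lt ?_ h1
  generalize -Real.log (1 - x) = l at *
  have hd : 0 < (1 - x) * l := by positivity
  generalize (∑' m, rr m * qq m) - (∑' m, rr m * qq m * x ^ (m + 1)) = S at *
  have e1 : S / ((1 - x) * l) - K * x⁻¹ = (S - K * ((1 - x) * l / x)) / ((1 - x) * l) := by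
    field_simp
  rw [e1, abs_div, abs_of_pos hd, div_le_iff₀ hd]
  refine hb.trans (le_of_eq ?_)
  field_simp

lemma Fser_deriv (u : ℝ) (h0 : 0 < u) (h1 : u < 1 / 27) :
    Summable (fun m : ℕ => fcCoeff (m + 1) * (((m : ℝ) + 1) * u ^ m)) ∧
    deriv Fser u = ∑' m : ℕ, fcCoeff (m + 1) * (((m : ℝ) + 1) * u ^ m) := by
  obtain ⟨B, hB, hr⟩ := rr_bdd
  obtain ⟨v, hv1, hv2⟩ := exists_between h1
  have hv0 : 0 < v := h0.trans hv1
  have hpos : ∀ m, 0 < fcCoeff (m + 1) := fun m => by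
    unfold fcCoeff
    rw [if_neg (Nat.succ_ne_zero m)]
    positivity
  have hsum : Summable (fun m : ℕ => 27 * B * (27 * v) ^ m) :=
    (summable_geometric_of_lt_one (by positivity) (by linarith)).mul_left _
  have hbd : ∀ (m : ℕ) (y : ℝ), y ∈ Set.Ioo 0 v →
      ‖fcCoeff (m + 1) * (((m : ℝ) + 1) * y ^ m)‖ ≤ 27 * B * (27 * v) ^ m := by
    intro m y hy
    have hy0 : 0 < y := hy.1
    have hc := hpos m
    rw [Real.norm_of_nonneg (by positivity)]
    have e : fcCoeff (m + 1) * (((m : ℝ) + 1) * y ^ m)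
        = 27 * (rr m / (m + 2)) * (27 * y) ^ m := by
      unfold rr
      rw [mul_pow, pow_succ]
      field_simp
    rw [e]
    have hq : rr m / ((m : ℝ) + 2) ≤ B :=
      (div_le_self (rr_pos m).le (by linarith [(Nat.cast_nonneg m : (0 : ℝ) ≤ m)])).trans (hr m)
    have hyv := hy.2.le
    gcongr
  refine ⟨Summable.of_norm_bounded hsum fun m => hbd m u ⟨h0, hv1⟩, ?_⟩
  rw [Fser_shift]
  refine HasDerivAt.deriv ?_
  refine hasDerivAt_tsum_of_isPreconnected (t := Set.Ioo 0 v) (y₀ := u) hsum isOpen_Ioo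
    isPreconnected_Ioo ?_ hbd ⟨h0, hv1⟩ ?_ ⟨h0, hv1⟩
  · intro m y _
    have := (hasDerivAt_pow (m + 1) y).const_mul (fcCoeff (m + 1))
    simpa using this
  · simp_rw [term_eq]
    exact summ_rqx _ (by linarith) (by linarith)

lemma deriv_atTop : Tendsto (deriv Fser) (𝓝[<] (1 / 27)) atTop := by
  have hpos : ∀ m, 0 < fcCoeff (m + 1) := fun m => by
    unfold fcCoeff
    rw [if_neg (Nat.succ_ne_zero m)]
    positivity
  have hns : ¬ Summable (fun m : ℕ => fcCoeff (m + 1) * (((m : ℝ) + 1) * (1 / 27) ^ m)) := by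
    intro hs
    obtain ⟨K, hK, h⟩ := rr_tendsto
    have h1 : Summable (fun m : ℕ => 1 / ((m : ℝ) + 2)) := by
      refine Summable.of_norm_bounded_eventually_nat (hs.mul_left (2 / K / 27)) ?_
      filter_upwards [h.eventually (lt_mem_nhds (show K / 2 < K by linarith))] with m hm
      rw [Real.norm_of_nonneg (by positivity)]
      have e : fcCoeff (m + 1) * (((m : ℝ) + 1) * (1 / 27) ^ m)
          = 27 * (rr m / (m + 2)) := by
        unfold rr
        rw [div_pow, one_pow, pow_succ]
        field_simp
      rw [e]
      have e2 : 2 / K / 27 * (27 * (rr m / ((m : ℝ) + 2))) = (2 * rr m / K) / ((m : ℝ) + 2) := by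
        field_simp
      rw [e2]
      gcongr
      rw [le_div_iff₀ hK]
      linarith
    have h2 := (summable_nat_add_iff (f := fun n : ℕ => 1 / (n : ℝ)) 2).mp (by simpa using h1)
    exact Real.not_summable_one_div_natCast h2
  rw [not_summable_iff_tendsto_nat_atTop_of_nonneg
    (fun m => by have := hpos m; positivity)] at hns
  rw [tendsto_atTop]
  intro b
  obtain ⟨N, hN⟩ := (hns.eventually_gt_atTop b).exists
  have hc : Continuous (fun u : ℝ => ∑ m ∈ Finset.range N,
      fcCoeff (m + 1) * (((m : ℝ) + 1) * u ^ m)) := by fun_prop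
  have hev : ∀ᶠ u : ℝ in 𝓝[<] (1 / 27), b < ∑ m ∈ Finset.range N,
      fcCoeff (m + 1) * (((m : ℝ) + 1) * u ^ m) :=
    nhdsWithin_le_nhds ((hc.tendsto (1 / 27)).eventually (lt_mem_nhds hN))
  have hp : ∀ᶠ x : ℝ in 𝓝[<] (1 / 27), 0 < x :=
    nhdsWithin_le_nhds (lt_mem_nhds (by norm_num))
  filter_upwards [hev, hp, self_mem_nhdsWithin] with u h1 h2 h3
  obtain ⟨hs, hd⟩ := Fser_deriv u h2 h3
  rw [hd]
  refine h1.le.trans (hs.sum_le_tsum _ fun m _ => ?_)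
  have := hpos m
  positivity

/-- As `u → (1/27)⁻`, `F(u)` converges to a finite limit `L = F(1/27)`, the singular
behavior `L − F(u) ∼ C·(1/27 − u)·log(1/(1/27 − u))` holds for some `C > 0`
(the ratio tends to `C`), and `F'` diverges (logarithmically) at `1/27`. -/
theorem stmt_11 :
    ∃ L : ℝ,
      Filter.Tendsto Fser (nhdsWithin (1 / 27) (Set.Iio (1 / 27))) (nhds L) ∧
      (∃ C : ℝ, 0 < C ∧
        Filter.Tendsto
          (fun u : ℝ => (L - Fser u) / ((1 / 27 - u) * Real.log (1 / (1 / 27 - u))))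
          (nhdsWithin (1 / 27) (Set.Iio (1 / 27))) (nhds C)) ∧
      Filter.Tendsto (deriv Fser) (nhdsWithin (1 / 27) (Set.Iio (1 / 27)))
        Filter.atTop := by
  obtain ⟨K, hK, hr⟩ := rr_tendsto
  have hsub : Tendsto (fun x : ℝ => 1 / 27 - x) (𝓝[<] (1 / 27)) (𝓝[>] 0) := by
    refine tendsto_nhdsWithin_iff.mpr ⟨?_, ?_⟩
    · have : Tendsto (fun x : ℝ => 1 / 27 - x) (𝓝 (1 / 27)) (𝓝 (1 / 27 - 1 / 27)) :=
        (continuous_const.sub continuous_id).tendsto (1 / 27)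
      rw [sub_self] at this
      exact this.mono_left nhdsWithin_le_nhds
    · filter_upwards [self_mem_nhdsWithin] with x hx
      exact sub_pos.mpr (Set.mem_Iio.mp hx)
  have hlog : Tendsto (fun x : ℝ => -Real.log (1 / 27 - x)) (𝓝[<] (1 / 27)) atTop :=
    tendsto_neg_atBot_atTop.comp (Real.tendsto_log_nhdsGT_zero.comp hsub)
  have hmul : Tendsto (fun u : ℝ => 27 * u) (𝓝[<] (1 / 27)) (𝓝[<] 1) := by
    refine tendsto_nhdsWithin_iff.mpr ⟨?_, ?_⟩
    · have : Tendsto (fun x : ℝ => 27 * x) (𝓝 (1 / 27)) (𝓝 (27 * (1 / 27))) :=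
        (continuous_const.mul continuous_id).tendsto (1 / 27)
      rw [show (27 : ℝ) * (1 / 27) = 1 by norm_num] at this
      exact this.mono_left nhdsWithin_le_nhds
    · filter_upwards [self_mem_nhdsWithin] with x hx
      have hx : x < 1 / 27 := hx
      show 27 * x < 1
      linarith
  have hab := (abel K hr).comp hmul
  have hfac : Tendsto (fun u : ℝ => 27 * (1 - Real.log 27 / (-Real.log (1 / 27 - u))))
      (𝓝[<] (1 / 27)) (𝓝 (27 * (1 - 0))) :=
    ((hlog.const_div_atTop (Real.log 27)).const_sub 1).const_mul 27
  have hratio : Tendsto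
      (fun u : ℝ => ((∑' m, rr m * qq m) - Fser u) /
        ((1 / 27 - u) * Real.log (1 / (1 / 27 - u)))) (𝓝[<] (1 / 27)) (𝓝 (K * (27 * (1 - 0)))) := by
    refine (hab.mul hfac).congr' ?_
    filter_upwards [self_mem_nhdsWithin, hlog.eventually_gt_atTop 0,
      hlog.eventually_gt_atTop (Real.log 27)] with u h1 h2 h3
    have h1 : u < 1 / 27 := h1
    have ht : 0 < 1 / 27 - u := by linarith
    have e1 : 1 - 27 * u = 27 * (1 / 27 - u) := by ring
    simp only [Function.comp]
    rw [Fser_eq, one_div (1 / 27 - u), Real.log_inv, e1, Real.log_mul (by norm_num) ht.ne']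
    generalize (∑' m, rr m * qq m) - (∑' m, rr m * qq m * (27 * u) ^ (m + 1)) = S at *
    have e2 : -(Real.log 27 + Real.log (1 / 27 - u))
        = -Real.log (1 / 27 - u) - Real.log 27 := by ring
    rw [e2]
    generalize -Real.log (1 / 27 - u) = l at *
    generalize 1 / 27 - u = t at *
    have h4 : l - Real.log 27 ≠ 0 := by linarith
    field_simp
  refine ⟨∑' m, rr m * qq m, ?_, ⟨K * (27 * (1 - 0)), by linarith, hratio⟩, deriv_atTop⟩
  have hden : Tendsto (fun u : ℝ => (1 / 27 - u) * Real.log (1 / (1 / 27 - u)))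
      (𝓝[<] (1 / 27)) (𝓝 0) := by
    have h := (tendsto_log_mul_rpow_nhdsGT_zero one_pos).comp hsub
    have h' := h.neg
    rw [neg_zero] at h'
    refine h'.congr fun u => ?_
    simp only [Function.comp, Real.rpow_one]
    rw [one_div (1 / 27 - u), Real.log_inv]
    ring
  have hprod := (hratio.mul hden).const_sub (∑' m, rr m * qq m)
  rw [mul_zero, sub_zero] at hprod
  refine hprod.congr' ?_
  filter_upwards [self_mem_nhdsWithin, hlog.eventually_gt_atTop 0] with u h1 h2
  have h1 : u < 1 / 27 := h1
  have ht : 0 < 1 / 27 - u := by linarith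
  have : (1 / 27 - u) * Real.log (1 / (1 / 27 - u)) ≠ 0 := by
    rw [one_div (1 / 27 - u), Real.log_inv]
    exact (mul_pos ht h2).ne'
  rw [div_mul_cancel₀ _ this]
  ring
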